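/- Let i ∈ {1, …, n}. Then for all c ∈ {1, …, h}, all parities (ε₁, ε₂), and writing r := i: (1) if 1 ≤ c ≤ m and lᵢ(c) = 1, then bᵢ sends (c, −r, (ε₁, ε₂)) to (−c, r, (ε₁ + 1, ε₂ + 1)) and sends (−c, r, (ε₁, ε₂)) to (c, −r, (ε₁ + 1, ε₂ + 1)) (the two cubies are exchanged without a net top/bottom flip); (2) if c > m or lᵢ(c) = 0, then bᵢ sends (c, r, (ε₁, ε₂)) to (−c, r, (ε₁, ε₂ + 1)) and sends (−c, r, (ε₁, ε₂)) to (c, r, (ε₁, ε₂ + 1)) (the two cubies are exchanged and both are flipped); (3) bᵢ fixes every element of S not moved in (1) or (2). -/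

import Mathlib

namespace RSq

def I (h : ℕ) : Type := {i : ℤ // i ≠ 0 ∧ |i| ≤ (h : ℤ)}

instance (h : ℕ) : DecidableEq (I h) :=
  inferInstanceAs (DecidableEq {i : ℤ // i ≠ 0 ∧ |i| ≤ (h : ℤ)})

instance (h : ℕ) : Neg (I h) :=
  ⟨fun i => ⟨-i.1, neg_ne_zero.mpr i.2.1, by rw [abs_neg]; exact i.2.2⟩⟩

@[simp] theorem I.neg_neg {h : ℕ} (i : I h) : -(-i) = i :=
  Subtype.ext (by show -(-i.1) = i.1; exact _root_.neg_neg i.1)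

abbrev S (h : ℕ) : Type := I h × I h × (ZMod 2 × ZMod 2)

@[simp] theorem zmod2_add_one_one (ε : ZMod 2) : ε + 1 + 1 = ε := by revert ε; decide

/-- Column move: flips column `j`. -/
def X {h : ℕ} (j : I h) : Equiv.Perm (S h) :=
  Function.Involutive.toPerm
    (fun s => if s.1 = j then (s.1, -s.2.1, (s.2.2.1 + 1, s.2.2.2)) else s)
    (by
      rintro ⟨c, r, ε₁, ε₂⟩
      by_cases hc : c = j <;> simp [hc])

/-- Row move: flips row `i`. -/
def Y {h : ℕ} (i : I h) : Equiv.Perm (S h) :=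
  Function.Involutive.toPerm
    (fun s => if s.2.1 = i then (-s.1, s.2.1, (s.2.2.1, s.2.2.2 + 1)) else s)
    (by
      rintro ⟨c, r, ε₁, ε₂⟩
      by_cases hr : r = i <;> simp [hr])

/-- The side-length parameter: `h = max m n + 2n`. -/
abbrev hS (n m : ℕ) : ℕ := max m n + 2 * n

def bit {m : ℕ} (w : Fin m → Bool) (c : ℤ) : Bool :=
  if hc : 1 ≤ c ∧ c ≤ (m : ℤ) then w ⟨(c - 1).toNat, by omega⟩ else false

def colIdx {n m : ℕ} (j : Fin m) : I (hS n m) :=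
  ⟨((j : ℕ) : ℤ) + 1, by
    have hj : (j : ℕ) < m := j.isLt
    have hm : m ≤ hS n m := le_trans (le_max_left m n) (Nat.le_add_right _ _)
    constructor
    · omega
    · rw [abs_of_nonneg (by omega)]; omega⟩

def rowIdx {n m : ℕ} (i : Fin n) : I (hS n m) :=
  ⟨((i : ℕ) : ℤ) + 1, by
    have hi : (i : ℕ) < n := i.isLt
    have hn : n ≤ hS n m := le_trans (le_max_right m n) (Nat.le_add_right _ _)
    constructor
    · omega
    · rw [abs_of_nonneg (by omega)]; omega⟩

/-- `aᵢ := (X 1)^{lᵢ(1)} ⋯ (X m)^{lᵢ(m)}`. -/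
def a {n m : ℕ} (l : Fin n → Fin m → Bool) (i : Fin n) : Equiv.Perm (S (hS n m)) :=
  ((List.finRange m).map (fun j => X (colIdx (n := n) j) ^ (if l i j then 1 else 0))).prod

/-- `bᵢ := aᵢ⁻¹ · (Y i) · aᵢ`. -/
def b {n m : ℕ} (l : Fin n → Fin m → Bool) (i : Fin n) : Equiv.Perm (S (hS n m)) :=
  (a l i)⁻¹ * Y (rowIdx (m := m) i) * a l i

/-- `t := a₁ · b₁ · b₂ ⋯ bₙ`. -/
def t {n m : ℕ} (hn : 0 < n) (l : Fin n → Fin m → Bool) : Equiv.Perm (S (hS n m)) :=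
  a l ⟨0, hn⟩ * ((List.finRange n).map (b l)).prod


/-- The effect of a column move on a cubie of that column. -/
def flipRow {h : ℕ} (s : S h) : S h := (s.1, -s.2.1, (s.2.2.1 + 1, s.2.2.2))

theorem X_apply {h : ℕ} (j : I h) (s : S h) : X j s = if s.1 = j then flipRow s else s := rfl

theorem Y_apply {h : ℕ} (i : I h) (s : S h) :
    Y i s = if s.2.1 = i then (-s.1, s.2.1, (s.2.2.1, s.2.2.2 + 1)) else s := rfl

theorem colIdx_injective {n m : ℕ} : Function.Injective (colIdx (n := n) (m := m)) := by
  intro j k hjk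
  have h : ((j : ℕ) : ℤ) + 1 = ((k : ℕ) : ℤ) + 1 := congrArg Subtype.val hjk
  exact Fin.ext (by omega)

theorem bit_eq_true_iff {n m : ℕ} (w : Fin m → Bool) (c : I (hS n m)) :
    bit w c.1 = true ↔ ∃ j, w j = true ∧ c = colIdx j := by
  unfold bit
  split_ifs with hc
  · have key : c = colIdx (n := n) (⟨(c.1 - 1).toNat, by omega⟩ : Fin m) :=
      Subtype.ext (show c.1 = (((c.1 - 1).toNat : ℕ) : ℤ) + 1 by omega)
    constructor
    · exact fun hw => ⟨_, hw, key⟩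
    · rintro ⟨j, hw, hj⟩
      rwa [← colIdx_injective (hj.symm.trans key)]
  · simp only [false_iff]
    rintro ⟨j, -, rfl⟩
    have := j.isLt
    exact hc (show 1 ≤ ((j : ℕ) : ℤ) + 1 ∧ ((j : ℕ) : ℤ) + 1 ≤ (m : ℤ) by omega)

open Classical in
theorem prod_map_X_apply {n m : ℕ} (w : Fin m → Bool) (L : List (Fin m)) (hL : L.Nodup)
    (s : S (hS n m)) :
    (L.map (fun j => X (colIdx (n := n) j) ^ (if w j then 1 else 0))).prod s =
      if ∃ j ∈ L, w j = true ∧ s.1 = colIdx j then flipRow s else s := by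
  induction L with
  | nil => simp
  | cons k L ih =>
    obtain ⟨hk, hL⟩ := List.nodup_cons.mp hL
    rw [List.map_cons, List.prod_cons, Equiv.Perm.mul_apply, ih hL]
    by_cases hw : w k = true
    · simp only [hw, if_true, pow_one, X_apply, List.exists_mem_cons_iff, true_and]
      by_cases hs : s.1 = colIdx k
      · have hn : ¬ ∃ j ∈ L, w j = true ∧ s.1 = colIdx j := by
          rintro ⟨j, hj, -, h⟩
          exact hk (colIdx_injective (hs.symm.trans h) ▸ hj)
        rw [if_neg hn, if_pos hs, if_pos (Or.inl hs)]
      · rw [if_neg (by split_ifs <;> exact hs)]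
        simp only [hs, false_or]
    · simp [hw]

theorem a_apply {n m : ℕ} (l : Fin n → Fin m → Bool) (i : Fin n) (s : S (hS n m)) :
    a l i s = if bit (l i) s.1.1 = true then flipRow s else s := by
  classical
  rw [a, prod_map_X_apply _ _ (List.nodup_finRange m)]
  simp [bit_eq_true_iff]

theorem a_inv {n m : ℕ} (l : Fin n → Fin m → Bool) (i : Fin n) : (a l i)⁻¹ = a l i := by
  rw [inv_eq_iff_mul_eq_one]
  ext1 s
  rw [Equiv.Perm.mul_apply, a_apply l i s]
  split_ifs with h
  · rw [a_apply, if_pos (show bit (l i) (flipRow s).1.1 = true from h)]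
    simp [flipRow]
  · rw [a_apply, if_neg h]
    rfl

theorem b_apply {n m : ℕ} (l : Fin n → Fin m → Bool) (i : Fin n) (s : S (hS n m)) :
    b l i s = a l i (Y (rowIdx i) (a l i s)) := by
  rw [b, a_inv]
  rfl

theorem I.neg_val {h : ℕ} (c : I h) : (-c).1 = -c.1 := rfl

theorem bit_of_nonpos {m : ℕ} (w : Fin m → Bool) {c : ℤ} (hc : c ≤ 0) : bit w c = false :=
  dif_neg (by omega)

/-- the effect of `bᵢ` on the Rubik's Square. -/
theorem stmt_1 (n m : ℕ) (hn : 0 < n) (hm : 0 < m) (l : Fin n → Fin m → Bool)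
    (i : Fin n) :
    (∀ (c : I (hS n m)) (ε₁ ε₂ : ZMod 2), 1 ≤ c.1 →
      (bit (l i) c.1 = true →
        b l i (c, -(rowIdx (m := m) i), (ε₁, ε₂)) =
          (-c, rowIdx (m := m) i, (ε₁ + 1, ε₂ + 1)) ∧
        b l i (-c, rowIdx (m := m) i, (ε₁, ε₂)) =
          (c, -(rowIdx (m := m) i), (ε₁ + 1, ε₂ + 1))) ∧
      (bit (l i) c.1 = false →
        b l i (c, rowIdx (m := m) i, (ε₁, ε₂)) =
          (-c, rowIdx (m := m) i, (ε₁, ε₂ + 1)) ∧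
        b l i (-c, rowIdx (m := m) i, (ε₁, ε₂)) =
          (c, rowIdx (m := m) i, (ε₁, ε₂ + 1)))) ∧
    (∀ s : S (hS n m),
      ¬(s.2.1 = -(rowIdx (m := m) i) ∧ 1 ≤ s.1.1 ∧ bit (l i) s.1.1 = true) →
      ¬(s.2.1 = rowIdx (m := m) i ∧ s.1.1 ≤ -1 ∧ bit (l i) (-s.1.1) = true) →
      ¬(s.2.1 = rowIdx (m := m) i ∧ 1 ≤ s.1.1 ∧ bit (l i) s.1.1 = false) →
      ¬(s.2.1 = rowIdx (m := m) i ∧ s.1.1 ≤ -1 ∧ bit (l i) (-s.1.1) = false) →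
      b l i s = s) := by
  refine ⟨fun c ε₁ ε₂ hc => ?_, fun s h₁ h₂ h₃ h₄ => ?_⟩
  · have hneg : bit (l i) (-c).1 = false := bit_of_nonpos _ (by rw [I.neg_val]; omega)
    constructor <;> intro hb <;> simp [b_apply, a_apply, Y_apply, flipRow, hb, hneg]
  · obtain ⟨c, r, ε₁, ε₂⟩ := s
    have hc0 : c.1 ≠ 0 := c.2.1
    rcases lt_or_gt_of_ne hc0 with hc | hc
    · have hb : bit (l i) c.1 = false := bit_of_nonpos _ hc.le
      have hr : r ≠ rowIdx i := by
        rintro rfl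
        cases h : bit (l i) (-c.1)
        · exact h₄ ⟨rfl, by simpa using Int.le_sub_one_of_lt hc, h⟩
        · exact h₂ ⟨rfl, by simpa using Int.le_sub_one_of_lt hc, h⟩
      simp [b_apply, a_apply, Y_apply, hb, hr]
    · cases hb : bit (l i) c.1
      · have hr : r ≠ rowIdx i := fun hr => h₃ ⟨hr, hc, hb⟩
        simp [b_apply, a_apply, Y_apply, hb, hr]
      · have hr : -r ≠ rowIdx i := fun hr => h₁ ⟨by rw [← hr, I.neg_neg], hc, hb⟩
        simp [b_apply, a_apply, Y_apply, flipRow, hb, hr]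

end RSq
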